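/- In the example theory T (with E, R, and the P_i as described), if T_σ has a model companion T*_σ, then for some finite Δ ⊂ L and some k, T*_σ ⊢ θ_{Δ,k}, where θ_{Δ,k} is the L_σ-sentence (∀x_0,…,x_{k−1},y_0,…,y_{k−1},z)[χ_{Δ,k}(x̄,ȳ,z) → (∃x_0,y_0,x_1,y_1)(ψ(x_0,y_0,z) ∧ ψ(x_1,y_1,z) ∧ σ(x_1)=y_1)]. -/

import Mathlib

namespace PaperAut

open FirstOrder Language Structure Set

/-- The language with a single unary function symbol `σ` and nothing else. -/
def sigmaFuncs : ℕ → Type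
  | 1 => Unit
  | _ => Empty

def sigmaLang : FirstOrder.Language := ⟨sigmaFuncs, fun _ => Empty⟩

/-- `L_σ`: the language `L` together with a new unary function symbol `σ`. -/
abbrev Lsig (L : FirstOrder.Language) : FirstOrder.Language := L.sum sigmaLang

/-- The new unary function symbol `σ`. -/
def sigSymb : sigmaLang.Functions 1 := (⟨⟩ : Unit)

variable (L : FirstOrder.Language)

/-- The interpretation of the symbol `σ` in an `L_σ`-structure. -/
def sigmaMap (M : Type*) [(Lsig L).Structure M] : M → M :=
  fun x => Structure.funMap (L := Lsig L) (Sum.inr sigSymb) ![x]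

/-- The `L`-reduct structure of an `L_σ`-structure. -/
def redL (M : Type*) [(Lsig L).Structure M] : L.Structure M :=
  (LHom.sumInl : L →ᴸ Lsig L).reduct M

/-- `M` is a model of `T_σ`: its `L`-reduct models `T` and `σ` is an `L`-automorphism. -/
def IsTsigmaModel (T : L.Theory) (M : Type*) [(Lsig L).Structure M] : Prop :=
  (letI := redL L M; M ⊨ T) ∧
  Function.Bijective (sigmaMap L M) ∧
  (letI := redL L M;
    ∀ (r : ℕ) (R : L.Relations r) (x : Fin r → M),
      Structure.RelMap R (sigmaMap L M ∘ x) ↔ Structure.RelMap R x)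

/-- A set of `L`-formulas, each with `m` designated type-variables and `k`
parameter-variables. -/
abbrev FmlSet : Type _ := Set ((m : ℕ) × (k : ℕ) × L.Formula (Fin m ⊕ Fin k))

variable {L}

/-- Concatenation of `l` many `p`-tuples of a sequence, selected by `s`. -/
def seqConcat {M : Type*} {p l : ℕ} (e : ℕ → Fin p → M) (s : Fin l → ℕ) :
    Fin (l * p) → M :=
  fun j => e (s (finProdFinEquiv.symm j).1) ((finProdFinEquiv.symm j).2)

/-- The sequence `⟨e_i : i ∈ Dom⟩` of `p`-tuples is `Δ`-indiscernible over the tuple `a`: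
any two properly ordered subsequences of equal length realize the same `Δ`-formulas with
parameters from `a`. -/
def DeltaIndisc (Δ : FmlSet L) {M : Type*} [L.Structure M] {p q : ℕ}
    (e : ℕ → Fin p → M) (Dom : Set ℕ) (a : Fin q → M) : Prop :=
  ∀ (m k : ℕ) (φ : L.Formula (Fin m ⊕ Fin k)),
    (⟨m, k, φ⟩ : (m : ℕ) × (k : ℕ) × L.Formula (Fin m ⊕ Fin k)) ∈ Δ →
    ∀ (l : ℕ) (h : m = l * p) (s t : Fin l → ℕ),
      StrictMono s → StrictMono t → (∀ j, s j ∈ Dom) → (∀ j, t j ∈ Dom) →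
      ∀ d : Fin k → M, (∀ j, d j ∈ Set.range a) →
        (φ.Realize (Sum.elim (seqConcat e s ∘ Fin.cast h) d) ↔
          φ.Realize (Sum.elim (seqConcat e t ∘ Fin.cast h) d))

/-- Concatenation of three `n`-tuples into a `3n`-tuple. -/
def tripleTup {M : Type*} {n : ℕ} (x y z : Fin n → M) : Fin (3 * n) → M :=
  fun j => Fin.append (Fin.append x y) z (Fin.cast (by ring) j)

/-- Extend a finite sequence of tuples to an `ℕ`-indexed one (junk values beyond). -/
noncomputable def padSeq {M : Type*} [Nonempty M] {p r : ℕ} (e : Fin r → Fin p → M) :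
    ℕ → Fin p → M :=
  fun i => if h : i < r then e ⟨i, h⟩ else fun _ => Classical.arbitrary M

/-- The `Δ`-averages (in the sense of Shelah: formulas satisfied by at least `f(Δ,n)/10`
members of the sequence) of the two sequences of `n`-tuples, with parameters from `P`,
are equal. -/
def AvgEqOn (f : FmlSet L → ℕ → ℕ) (Δ : FmlSet L) {M : Type*} [L.Structure M] {n : ℕ}
    (K₁ K₂ : ℕ) (e₁ e₂ : ℕ → Fin n → M) (P : Set M) : Prop :=
  ∀ (m k : ℕ) (φ : L.Formula (Fin m ⊕ Fin k)),
    (⟨m, k, φ⟩ : (m : ℕ) × (k : ℕ) × L.Formula (Fin m ⊕ Fin k)) ∈ Δ →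
    ∀ (h : m = n) (d : Fin k → M), (∀ j, d j ∈ P) →
      (f Δ n ≤ 10 * Nat.card {i : Fin K₁ // φ.Realize (Sum.elim (e₁ i ∘ Fin.cast h) d)} ↔
        f Δ n ≤ 10 * Nat.card {i : Fin K₂ // φ.Realize (Sum.elim (e₂ i ∘ Fin.cast h) d)})

/-- `τ_Δ`: `z` together with some strictly increasing subsequence of `⟨e_i : i ∈ S⟩` of
length `r` forms a `Δ`-indiscernible sequence over `a`. -/
def TauSem (Δ : FmlSet L) {M : Type*} [L.Structure M] [Nonempty M] {p q : ℕ} (r : ℕ)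
    (e : ℕ → Fin p → M) (S : Set ℕ) (a : Fin q → M) (z : Fin p → M) : Prop :=
  ∃ s : Fin r → ℕ, StrictMono s ∧ (∀ j, s j ∈ S) ∧
    DeltaIndisc Δ (padSeq (Fin.snoc (fun j => e (s j)) z)) (Set.Iio (r + 1)) a

variable (L)

/-- `⟨b̄ᵢ σ(b̄ᵢ) c̄ᵢ : i < K⟩ā` is a `(σ,Δ₁,Δ₂,Δ₃,n)`-obstruction over `A`. -/
def IsObstruction (F : FmlSet L → ℕ → FmlSet L) (f : FmlSet L → ℕ → ℕ)
    (Δ₁ Δ₂ Δ₃ : FmlSet L) (n : ℕ) {M : Type*} [L.Structure M] [Nonempty M]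
    (σ : M → M) (A : Set M) {q : ℕ} (a : Fin q → M)
    (K : ℕ) (b c : ℕ → Fin n → M) : Prop :=
  DeltaIndisc (F Δ₂ (3 * n)) (fun i => tripleTup (b i) (σ ∘ b i) (c i)) (Set.Iio K) a
  ∧ f Δ₂ (3 * n) ≤ K
  ∧ AvgEqOn f Δ₂ K K (fun i => σ ∘ b i) c Set.univ
  ∧ ∀ x x' y : Fin n → M,
      TauSem Δ₁ (f Δ₁ (3 * n)) (fun i => tripleTup (b i) (σ ∘ b i) (c i)) (Set.Iio K) a
        (tripleTup x x' y) →
      ∃ (m k : ℕ) (φ : L.Formula (Fin m ⊕ Fin k)),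
        (⟨m, k, φ⟩ : (m : ℕ) × (k : ℕ) × L.Formula (Fin m ⊕ Fin k)) ∈ Δ₃ ∧
        ∃ (h : m = n) (d : Fin k → M),
          (∀ j, d j ∈ A ∪ (⋃ i ∈ Set.Iio K, Set.range (tripleTup (b i) (σ ∘ b i) (c i)))
              ∪ Set.range a) ∧
          φ.Realize (Sum.elim (x' ∘ Fin.cast h) d) ∧ ¬ φ.Realize (Sum.elim (y ∘ Fin.cast h) d)


variable (L : FirstOrder.Language)

/-- `T` has the order property (some formula orders arbitrarily long finite sequences). -/
def HasOrderProp (T : L.Theory) : Prop :=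
  ∃ (n m : ℕ) (φ : L.Formula (Fin n ⊕ Fin m)), ∀ N : ℕ,
    ∃ (M : Type) (_ : L.Structure M) (a : Fin N → Fin n → M) (b : Fin N → Fin m → M),
      Nonempty M ∧ (M ⊨ T) ∧ ∀ i j : Fin N, φ.Realize (Sum.elim (a i) (b j)) ↔ i ≤ j

/-- `T` is stable: no formula has the order property. -/
def IsStable (T : L.Theory) : Prop := ¬ HasOrderProp L T

/-- `T` has the finite cover property: some formula `E(x̄,ȳ,z̄)` defines, for each value of
`z̄`, an equivalence relation, and for each `n` some instance has finitely many but more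
than `n` classes. -/
def HasFCP (T : L.Theory) : Prop :=
  ∃ (r m : ℕ) (E : L.Formula ((Fin r ⊕ Fin r) ⊕ Fin m)),
    (∀ (M : Type) [L.Structure M] [Nonempty M], M ⊨ T → ∀ d : Fin m → M,
      Equivalence (fun x y : Fin r → M => E.Realize (Sum.elim (Sum.elim x y) d))) ∧
    ∀ n : ℕ, ∃ (M : Type) (_ : L.Structure M), Nonempty M ∧ (M ⊨ T) ∧
      ∃ (d : Fin m → M) (k : ℕ), n < k ∧
        ∃ reps : Fin k → Fin r → M,
          (∀ i j : Fin k, i ≠ j → ¬ E.Realize (Sum.elim (Sum.elim (reps i) (reps j)) d)) ∧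
          (∀ x : Fin r → M, ∃ i, E.Realize (Sum.elim (Sum.elim x (reps i)) d))

/-- A theory is model complete if every embedding between its models is elementary. -/
def IsModelComplete {L' : FirstOrder.Language} (T' : L'.Theory) : Prop :=
  ∀ (M N : Type) [L'.Structure M] [L'.Structure N] [Nonempty M] [Nonempty N],
    M ⊨ T' → N ⊨ T' →
      ∀ (g : M ↪[L'] N) (k : ℕ) (φ : L'.Formula (Fin k)) (x : Fin k → M),
        φ.Realize (g ∘ x) ↔ φ.Realize x


/-- `T'` is a model companion of `T_σ`: `T'` is model complete and mutually
model-consistent with `T_σ`. -/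
def IsModelCompanionTsigma (T : L.Theory) (T' : (Lsig L).Theory) : Prop :=
  IsModelComplete T' ∧
  (∀ (M : Type) [(Lsig L).Structure M] [Nonempty M], IsTsigmaModel L T M →
    ∃ (N : Type) (_ : (Lsig L).Structure N), Nonempty N ∧ (N ⊨ T') ∧
      Nonempty (M ↪[Lsig L] N)) ∧
  (∀ (N : Type) [(Lsig L).Structure N] [Nonempty N], N ⊨ T' →
    ∃ (M : Type) (_ : (Lsig L).Structure M), Nonempty M ∧ IsTsigmaModel L T M ∧
      Nonempty (N ↪[Lsig L] M))

/-- `T_σ` has a model companion. -/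
def HasModelCompanionTsigma (T : L.Theory) : Prop :=
  ∃ T' : (Lsig L).Theory, IsModelCompanionTsigma L T T'

/-- `M` is an existentially closed model of `T_σ`. -/
def IsECTsigma (T : L.Theory) (M : Type) [(Lsig L).Structure M] : Prop :=
  Nonempty M ∧ IsTsigmaModel L T M ∧
  ∀ (N : Type) [(Lsig L).Structure N] [Nonempty N], IsTsigmaModel L T N →
    ∀ (g : M ↪[Lsig L] N) (k l : ℕ) (φ : (Lsig L).BoundedFormula (Fin k) l),
      φ.IsQF → ∀ a : Fin k → M,
        (∃ y : Fin l → N, φ.Realize (g ∘ a) y) → ∃ y : Fin l → M, φ.Realize a y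

/-- The pair of functions `Δ, n ↦ F(Δ,n)` and `Δ, n ↦ f(Δ,n)` has the properties furnished
by stability of `T` (Shelah II.2.17, II.4.13): `F(Δ,n) ⊇ Δ` is finite for finite `Δ`, both
functions are increasing, and on any `F(Δ,n)`-indiscernible sequence of `n`-tuples of
length at least `f(Δ,n)`, each `Δ`-formula with parameters holds on fewer than `f(Δ,n)/2`
members or fails on fewer than `f(Δ,n)/2` members. -/
def GoodFf (T : L.Theory) (F : FmlSet L → ℕ → FmlSet L) (f : FmlSet L → ℕ → ℕ) : Prop :=
  (∀ (Δ : FmlSet L) (n : ℕ), Δ ⊆ F Δ n) ∧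
  (∀ (Δ : FmlSet L) (n : ℕ), Δ.Finite → (F Δ n).Finite) ∧
  (∀ (Δ Δ' : FmlSet L) (n n' : ℕ), Δ ⊆ Δ' → n ≤ n' → F Δ n ⊆ F Δ' n' ∧ f Δ n ≤ f Δ' n') ∧
  (∀ (Δ : FmlSet L) (n : ℕ), 0 < f Δ n) ∧
  (∀ (Δ : FmlSet L) (n : ℕ) (M : Type) (_ : L.Structure M) (_ : Nonempty M),
    M ⊨ T → ∀ (K : ℕ) (e : ℕ → Fin n → M), f Δ n ≤ K →
      DeltaIndisc (F Δ n) e (Set.Iio K) (fun i : Fin 0 => i.elim0) →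
      ∀ (m k : ℕ) (φ : L.Formula (Fin m ⊕ Fin k)),
        (⟨m, k, φ⟩ : (m : ℕ) × (k : ℕ) × L.Formula (Fin m ⊕ Fin k)) ∈ Δ →
        ∀ (h : m = n) (d : Fin k → M),
          2 * Nat.card {i : Fin K // φ.Realize (Sum.elim (e i ∘ Fin.cast h) d)} < f Δ n ∨
          2 * Nat.card {i : Fin K // ¬ φ.Realize (Sum.elim (e i ∘ Fin.cast h) d)} < f Δ n)

/-- `T_σ` has obstructions: for some finite `Δ₁` and `n`, every finite `Δ₂ ⊇ F(Δ₁,3n)`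
admits an obstruction in some model of `T_σ`. -/
def TheoryHasObstructions (T : L.Theory) (F : FmlSet L → ℕ → FmlSet L)
    (f : FmlSet L → ℕ → ℕ) : Prop :=
  ∃ (Δ₁ : FmlSet L) (n : ℕ), Δ₁.Finite ∧
    ∀ Δ₂ : FmlSet L, Δ₂.Finite → F Δ₁ (3 * n) ⊆ Δ₂ →
      ∃ (Δ₃ : FmlSet L), Δ₃.Finite ∧
        ∃ (M : Type) (_ : (Lsig L).Structure M) (_ : Nonempty M), IsTsigmaModel L T M ∧
          ∃ (A : Set M), A.Finite ∧
            ∃ (q : ℕ) (a : Fin q → M) (K : ℕ) (b c : ℕ → Fin n → M),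
              (∀ j, a j ∈ A) ∧
              (letI := redL L M;
                IsObstruction L F f Δ₁ Δ₂ Δ₃ n (sigmaMap L M) A a K b c)

/-- `T` has simple obstructions: obstructions with respect to the identity automorphism,
in plain models of `T`. -/
def TheoryHasSimpleObstructions (T : L.Theory) (F : FmlSet L → ℕ → FmlSet L)
    (f : FmlSet L → ℕ → ℕ) : Prop :=
  ∃ (Δ₁ : FmlSet L) (n : ℕ), Δ₁.Finite ∧
    ∀ Δ₂ : FmlSet L, Δ₂.Finite → F Δ₁ (3 * n) ⊆ Δ₂ →
      ∃ (Δ₃ : FmlSet L), Δ₃.Finite ∧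
        ∃ (M : Type) (_ : L.Structure M) (_ : Nonempty M), (M ⊨ T) ∧
          ∃ (A : Set M), A.Finite ∧
            ∃ (q : ℕ) (a : Fin q → M) (K : ℕ) (b c : ℕ → Fin n → M),
              (∀ j, a j ∈ A) ∧
              IsObstruction L F f Δ₁ Δ₂ Δ₃ n (id : M → M) A a K b c

/-- `T_σ` has no `σ`-obstructions: there is a function `G(Δ₁,n) ⊇ F(Δ₁,3n)`, independent
of the model, such that no model of `T_σ` contains a `(σ,Δ₁,G(Δ₁,n),Δ₃,n)`-obstruction
over a finite set. -/
def TsigmaNoObstructions (T : L.Theory) (F : FmlSet L → ℕ → FmlSet L)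
    (f : FmlSet L → ℕ → ℕ) : Prop :=
  ∃ G : FmlSet L → ℕ → FmlSet L,
    (∀ (Δ₁ : FmlSet L) (n : ℕ), F Δ₁ (3 * n) ⊆ G Δ₁ n ∧ (Δ₁.Finite → (G Δ₁ n).Finite)) ∧
    ∀ (M : Type) [(Lsig L).Structure M] [Nonempty M], IsTsigmaModel L T M →
      ∀ (Δ₁ Δ₃ : FmlSet L), Δ₁.Finite → Δ₃.Finite →
        ∀ (n : ℕ) (A : Set M), A.Finite →
          ∀ (q : ℕ) (a : Fin q → M) (K : ℕ) (b c : ℕ → Fin n → M), (∀ j, a j ∈ A) →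
            (letI := redL L M;
              ¬ IsObstruction L F f Δ₁ (G Δ₁ n) Δ₃ n (sigmaMap L M) A a K b c)


/-! ### The example: `E`, `R`, and predicates `P_i` -/

/-- Relations of the example language: unary `P_i` (`i : ℕ`) and two binary relations. -/
def exRels : ℕ → Type
  | 1 => ℕ
  | 2 => Bool
  | _ => Empty

/-- The example language, with binary `E`, `R` and unary `P_i` for `i < ω`. -/
def exLang : FirstOrder.Language := ⟨fun _ => Empty, exRels⟩

def Esym : exLang.Relations 2 := true
def Rsym : exLang.Relations 2 := false
def Psym (i : ℕ) : exLang.Relations 1 := i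

def Esat {M : Type*} [exLang.Structure M] (x y : M) : Prop :=
  Structure.RelMap Esym ![x, y]
def Rsat {M : Type*} [exLang.Structure M] (x y : M) : Prop :=
  Structure.RelMap Rsym ![x, y]
def Psat {M : Type*} [exLang.Structure M] (i : ℕ) (x : M) : Prop :=
  Structure.RelMap (Psym i) ![x]

/-- `M` is a model of the example theory `T`: `E` is an equivalence relation with
infinitely many infinite classes, refined by `R` into two-element classes, and each `P_i`
holds only of elements of one `E`-class and contains exactly one element from each
`R`-class of that `E`-class. -/
def IsExModel (M : Type*) [exLang.Structure M] : Prop :=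
  Equivalence (Esat (M := M)) ∧
  (∀ k : ℕ, ∃ x : Fin k → M,
    (∀ i j, i ≠ j → ¬ Esat (x i) (x j)) ∧ ∀ i, {y : M | Esat (x i) y}.Infinite) ∧
  Equivalence (Rsat (M := M)) ∧
  (∀ x y : M, Rsat x y → Esat x y) ∧
  (∀ x : M, ∃ y : M, y ≠ x ∧ Rsat x y ∧ ∀ z : M, Rsat x z → z = x ∨ z = y) ∧
  (∀ (i : ℕ) (x y : M), Psat i x → Psat i y → Esat x y) ∧
  (∀ i : ℕ, ∃ x : M, Psat i x) ∧
  (∀ (i : ℕ) (x : M), Psat i x → ∀ y : M, Esat x y → ∃! z : M, Rsat y z ∧ Psat i z)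

/-- `M` is a model of `T_σ` for the example theory. -/
def IsExSigmaModel (M : Type*) [(Lsig exLang).Structure M] : Prop :=
  (letI := redL exLang M; IsExModel M) ∧
  Function.Bijective (sigmaMap exLang M) ∧
  (letI := redL exLang M;
    ∀ (r : ℕ) (R : exLang.Relations r) (x : Fin r → M),
      Structure.RelMap R (sigmaMap exLang M ∘ x) ↔ Structure.RelMap R x)

/-- The formula `ψ(x,y,z) : E(x,z) ∧ E(y,z) ∧ R(x,y) ∧ x ≠ y`, semantically. -/
def PsiSat {M : Type*} [(Lsig exLang).Structure M] (x y z : M) : Prop :=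
  letI := redL exLang M
  Esat x z ∧ Esat y z ∧ Rsat x y ∧ x ≠ y

/-- The pair `(x_i, y_i)` as a 2-tuple. -/
def pairTup {M : Type*} (p : M × M) : Fin 2 → M := ![p.1, p.2]

/-- `⟨x_i y_i : i < ω⟩, z` realizes the type `Γ`: each `ψ(x_i,y_i,z)` holds, the sequence
`⟨x_i y_i⟩` is `L`-indiscernible, and for every `L`-formula `φ(x,w̄)` and every `w̄`, a
majority of any `lg(w̄)+3` of the indices `i` satisfy `φ(x_i,w̄) ↔ φ(y_i,σ(w̄))`. -/
def RealizesGamma (N : Type) [(Lsig exLang).Structure N] (w : ℕ → N × N) (aN : N) :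
    Prop :=
  (∀ i : ℕ, PsiSat (w i).1 (w i).2 aN) ∧
  (letI := redL exLang N;
    DeltaIndisc (Set.univ : FmlSet exLang) (fun i => pairTup (w i)) Set.univ
      (fun i : Fin 0 => i.elim0)) ∧
  (letI := redL exLang N;
    ∀ (l : ℕ) (φ : exLang.Formula (Fin (l + 1))) (d : Fin l → N),
      l + 3 < 2 * Nat.card {i : Fin (l + 3) //
        (φ.Realize (Fin.cons (w i).1 d) ↔
          φ.Realize (Fin.cons (w i).2 (sigmaMap exLang N ∘ d)))})

/-- The `(2k+1)`-tuple `b_0,…,b_{k-1},c_0,…,c_{k-1},a`. -/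
def arrTup {M : Type*} (k : ℕ) (b c : Fin k → M) (a : M) : Fin (2 * k + 1) → M :=
  fun j => if h : (j : ℕ) < k then b ⟨j, h⟩
    else if h' : (j : ℕ) < 2 * k then c ⟨(j : ℕ) - k, by omega⟩ else a

/-! ### Semantic description of `T_σ` for the example theory -/

section Helpers

/-- The axioms of `T_σ` for the example theory, for explicitly given relations and map. -/
structure ExAxioms {M : Type*} (E R : M → M → Prop) (P : ℕ → M → Prop) (s : M → M) : Prop where
  equivE : Equivalence E
  infinite_classes : ∀ k : ℕ, ∃ x : Fin k → M,
    (∀ i j, i ≠ j → ¬ E (x i) (x j)) ∧ ∀ i, {y : M | E (x i) y}.Infinite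
  equivR : Equivalence R
  refines : ∀ x y : M, R x y → E x y
  two_elements : ∀ x : M, ∃ y : M, y ≠ x ∧ R x y ∧ ∀ z : M, R x z → z = x ∨ z = y
  one_class : ∀ (i : ℕ) (x y : M), P i x → P i y → E x y
  nonempty_pred : ∀ i : ℕ, ∃ x : M, P i x
  selects : ∀ (i : ℕ) (x : M), P i x → ∀ y : M, E x y → ∃! z : M, R y z ∧ P i z
  bijective : Function.Bijective s
  map_E : ∀ x y, E (s x) (s y) ↔ E x y
  map_R : ∀ x y, R (s x) (s y) ↔ R x y
  map_P : ∀ i x, P i (s x) ↔ P i x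

theorem comp_singleton {α β : Type*} (f : α → β) (x : α) : f ∘ ![x] = ![f x] := by
  ext j; fin_cases j; rfl

theorem comp_pair {α β : Type*} (f : α → β) (x y : α) : f ∘ ![x, y] = ![f x, f y] := by
  ext j; fin_cases j <;> rfl

variable {M : Type*} [(Lsig exLang).Structure M]

/-- The relation `E` of an `L_σ`-structure. -/
def relE (x y : M) : Prop := RelMap (L := Lsig exLang) (Sum.inl Esym) ![x, y]

/-- The relation `R` of an `L_σ`-structure. -/
def relR (x y : M) : Prop := RelMap (L := Lsig exLang) (Sum.inl Rsym) ![x, y]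

/-- The predicate `P_i` of an `L_σ`-structure. -/
def relP (i : ℕ) (x : M) : Prop := RelMap (L := Lsig exLang) (Sum.inl (Psym i)) ![x]

theorem isExSigmaModel_iff :
    IsExSigmaModel M ↔ ExAxioms (relE (M := M)) relR relP (sigmaMap exLang M) := by
  constructor
  · rintro ⟨⟨h1, h2, h3, h4, h5, h6, h7, h8⟩, hb, ha⟩
    refine ⟨h1, h2, h3, h4, h5, h6, h7, h8, hb, fun x y => ?_, fun x y => ?_, fun i x => ?_⟩
    · have h := ha 2 Esym ![x, y]
      rw [comp_pair] at h
      exact h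
    · have h := ha 2 Rsym ![x, y]
      rw [comp_pair] at h
      exact h
    · have h := ha 1 (Psym i) ![x]
      rw [comp_singleton] at h
      exact h
  · rintro ⟨h1, h2, h3, h4, h5, h6, h7, h8, hb, hE, hR, hP⟩
    refine ⟨⟨h1, h2, h3, h4, h5, h6, h7, h8⟩, hb, fun r S x => ?_⟩
    match r, S, x with
    | 0, S, _ => exact S.elim
    | 1, i, x =>
      obtain ⟨a, rfl⟩ : ∃ a, x = ![a] := ⟨x 0, by ext j; fin_cases j; rfl⟩
      rw [comp_singleton]
      exact hP i a
    | 2, S, x =>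
      obtain ⟨a, b, rfl⟩ : ∃ a b, x = ![a, b] := ⟨x 0, x 1, by ext j; fin_cases j <;> rfl⟩
      rw [comp_pair]
      cases S
      · exact hR a b
      · exact hE a b
    | _ + 3, S, _ => exact S.elim

/-- The `L_σ`-structure with prescribed relations and unary map. -/
@[reducible] def exStructure {M : Type*} (E R : M → M → Prop) (P : ℕ → M → Prop) (s : M → M) :
    (Lsig exLang).Structure M where
  funMap {n} f x := match n, f, x with
    | _, Sum.inl f, _ => Empty.elim f
    | 0, Sum.inr f, _ => Empty.elim f
    | 1, Sum.inr _, x => s (x 0)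
    | _ + 2, Sum.inr f, _ => Empty.elim f
  RelMap {n} S x := match n, S, x with
    | _, Sum.inr S, _ => Empty.elim S
    | 0, Sum.inl S, _ => Empty.elim S
    | 1, Sum.inl i, x => P i (x 0)
    | 2, Sum.inl true, x => E (x 0) (x 1)
    | 2, Sum.inl false, x => R (x 0) (x 1)
    | _ + 3, Sum.inl S, _ => Empty.elim S

theorem isExSigmaModel_exStructure {M : Type*} {E R : M → M → Prop} {P : ℕ → M → Prop}
    {s : M → M} (h : ExAxioms E R P s) :
    letI := exStructure E R P s
    IsExSigmaModel M :=
  letI := exStructure E R P s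
  isExSigmaModel_iff.2 h

section Embedding

variable {N : Type*} [(Lsig exLang).Structure N] (g : M ↪[Lsig exLang] N)

theorem relE_map (x y : M) : relE (g x) (g y) ↔ relE x y := by
  have h := g.map_rel (Sum.inl Esym) ![x, y]
  rwa [comp_pair] at h

theorem relR_map (x y : M) : relR (g x) (g y) ↔ relR x y := by
  have h := g.map_rel (Sum.inl Rsym) ![x, y]
  rwa [comp_pair] at h

theorem relP_map (i : ℕ) (x : M) : relP i (g x) ↔ relP i x := by
  have h := g.map_rel (Sum.inl (Psym i)) ![x]
  rwa [comp_singleton] at h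

theorem sigmaMap_map (x : M) : sigmaMap exLang N (g x) = g (sigmaMap exLang M x) := by
  have h := g.map_fun (Sum.inr sigSymb) ![x]
  rw [comp_singleton] at h
  exact h.symm

end Embedding

/-! ### Two models of `T_σ` -/

/-- A model of the example theory in which distinct `P_i` live on distinct `E`-classes. -/
theorem exAxioms_separated :
    ExAxioms (M := ℕ × ℕ × Bool) (fun x y => x.1 = y.1) (fun x y => x.1 = y.1 ∧ x.2.1 = y.2.1)
      (fun i x => x.1 = i ∧ x.2.2 = true) id where
  equivE := ⟨fun _ => rfl, fun h => h.symm, fun h h' => h.trans h'⟩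
  infinite_classes k := by
    refine ⟨fun i => (i, 0, true), fun i j hij h => hij (Fin.ext h), fun i => ?_⟩
    refine Set.infinite_of_injective_forall_mem (f := fun n : ℕ => ((i : ℕ), n, true)) ?_ ?_
    · intro m n h
      simpa using h
    · intro n
      simp
  equivR := ⟨fun _ => ⟨rfl, rfl⟩, fun h => ⟨h.1.symm, h.2.symm⟩,
    fun h h' => ⟨h.1.trans h'.1, h.2.trans h'.2⟩⟩
  refines _ _ h := h.1
  two_elements := by
    rintro ⟨m, n, b⟩
    refine ⟨(m, n, !b), by simp, ⟨rfl, rfl⟩, ?_⟩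
    rintro ⟨m', n', b'⟩ ⟨h, h'⟩
    simp only at h h'
    subst h h'
    cases b <;> cases b' <;> simp
  one_class _ _ _ h h' := h.1.trans h'.1.symm
  nonempty_pred i := ⟨(i, 0, true), rfl, rfl⟩
  selects := by
    rintro i x ⟨rfl, -⟩ y hy
    refine ⟨(y.1, y.2.1, true), ⟨⟨rfl, rfl⟩, hy.symm, rfl⟩, ?_⟩
    rintro ⟨m, n, b⟩ ⟨⟨h, h'⟩, -, hb⟩
    simp only at h h' hb
    rw [h, h', hb]
  bijective := Function.bijective_id
  map_E _ _ := Iff.rfl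
  map_R _ _ := Iff.rfl
  map_P _ _ := Iff.rfl

/-- Adding to the `E`-class of `a` a new `R`-class whose two elements are swapped preserves the
axioms, provided that this class is fixed by `σ` and carries no `P_i`. -/
theorem ExAxioms.add_swapped_pair {K : Type*} {E R : K → K → Prop} {P : ℕ → K → Prop}
    {s : K → K} (h : ExAxioms E R P s) {a : K} (hfix : E a (s a))
    (hP : ∀ i x, P i x → ¬ E x a) :
    ExAxioms (M := K ⊕ Bool)
      (fun u v => E (Sum.elim id (fun _ => a) u) (Sum.elim id (fun _ => a) v))
      (Sum.LiftRel R fun _ _ => True)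
      (fun i => Sum.elim (P i) fun _ => False) (Sum.map s not) where
  equivE := ⟨fun _ => h.equivE.refl _, fun h' => h.equivE.symm h',
    fun h' h'' => h.equivE.trans h' h''⟩
  infinite_classes k := by
    obtain ⟨x, hx, hx'⟩ := h.infinite_classes k
    refine ⟨fun i => Sum.inl (x i), hx, fun i => ?_⟩
    refine ((hx' i).image (Sum.inl_injective (β := Bool)).injOn).mono ?_
    rintro _ ⟨y, hy, rfl⟩
    exact hy
  equivR := by
    refine ⟨?_, ?_, ?_⟩
    · rintro (x | x)
      · exact .inl (h.equivR.refl x)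
      · exact .inr trivial
    · rintro _ _ (h' | _)
      · exact .inl (h.equivR.symm h')
      · exact .inr trivial
    · rintro _ _ _ (h' | _) (h'' | _)
      · exact .inl (h.equivR.trans h' h'')
      · exact .inr trivial
  refines := by
    rintro _ _ (h' | _)
    · exact h.refines _ _ h'
    · exact h.equivE.refl a
  two_elements := by
    rintro (x | b)
    · obtain ⟨y, hy, hxy, hu⟩ := h.two_elements x
      refine ⟨.inl y, by simpa using hy, .inl hxy, ?_⟩
      rintro _ (h' | _)
      simpa using hu _ h'
    · refine ⟨.inr !b, by simp, .inr trivial, ?_⟩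
      rintro _ (_ | _)
      rename_i c _
      cases b <;> cases c <;> simp
  one_class := by
    rintro i (x | _) (y | _) hx hy
    · exact h.one_class i x y hx hy
    · exact hy.elim
    · exact hx.elim
    · exact hx.elim
  nonempty_pred i := (h.nonempty_pred i).elim fun x hx => ⟨.inl x, hx⟩
  selects := by
    rintro i (x | _) hx (y | _) hxy
    · obtain ⟨z, ⟨hz, hz'⟩, hu⟩ := h.selects i x hx y hxy
      refine ⟨.inl z, ⟨.inl hz, hz'⟩, ?_⟩
      rintro _ ⟨h' | _, h''⟩
      exact congrArg Sum.inl (hu _ ⟨h', h''⟩)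
    · exact (hP i x hx hxy).elim
    · exact hx.elim
    · exact hx.elim
  bijective := Sum.map_bijective.2 ⟨h.bijective, Bool.involutive_not.bijective⟩
  map_E := by
    have key : ∀ u : K ⊕ Bool, E (Sum.elim id (fun _ => a) (Sum.map s not u))
        (s (Sum.elim id (fun _ => a) u)) := by
      rintro (x | _)
      · exact h.equivE.refl _
      · exact hfix
    intro u v
    rw [← h.map_E (Sum.elim id (fun _ => a) u)]
    exact ⟨fun h' => h.equivE.trans (h.equivE.symm (key u)) (h.equivE.trans h' (key v)),
      fun h' => h.equivE.trans (key u) (h.equivE.trans h' (h.equivE.symm (key v)))⟩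
  map_R := by
    rintro (x | _) (y | _) <;> simp [h.map_R]
  map_P := by
    rintro i (x | _) <;> simp [h.map_P]

/-- In a class carrying some `P_i`, the automorphism swaps no two-element `R`-class. -/
theorem ExAxioms.fixed_of_pred {K : Type*} {E R : K → K → Prop} {P : ℕ → K → Prop}
    {s : K → K} (h : ExAxioms E R P s) {i : ℕ} {a x : K} (ha : P i a) (hax : E a x)
    (hx : R x (s x)) : s x = x := by
  obtain ⟨z, ⟨hxz, hz⟩, hu⟩ := h.selects i a ha x hax
  have hsz : s z = z :=
    hu _ ⟨h.equivR.trans hx ((h.map_R _ _).2 hxz), (h.map_P _ _).2 hz⟩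
  by_contra hne
  obtain ⟨y, -, -, hy⟩ := h.two_elements x
  have hsx : s x = y := (hy _ hx).resolve_left hne
  rcases hy z hxz with rfl | hzy
  · exact hne hsz
  · exact hne ((h.bijective.1 (hsz.trans (hzy.trans hsx.symm))).symm ▸ hsz)

/-- A model of `T_σ` embeds in one where `σ` swaps some `R`-class in the `E`-class of a given
element, if that class is fixed by `σ` and carries no `P_i`. -/
theorem exists_embedding_swapped_pair {K : Type} [(Lsig exLang).Structure K]
    (hK : IsExSigmaModel K) {a : K} (hfix : relE a (sigmaMap exLang K a))
    (hP : ∀ i x, relP i x → ¬ relE x a) :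
    ∃ (K' : Type) (_ : (Lsig exLang).Structure K') (g : K ↪[Lsig exLang] K'),
      IsExSigmaModel K' ∧ ∃ x : K', relE (g a) x ∧ relR x (sigmaMap exLang K' x) ∧
        sigmaMap exLang K' x ≠ x := by
  have h := (isExSigmaModel_iff.1 hK).add_swapped_pair hfix hP
  let _ := exStructure (M := K ⊕ Bool)
    (fun u v => relE (Sum.elim id (fun _ => a) u) (Sum.elim id (fun _ => a) v))
    (Sum.LiftRel relR fun _ _ => True)
    (fun i => Sum.elim (relP i) fun _ => False) (Sum.map (sigmaMap exLang K) not)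
  refine ⟨K ⊕ Bool, inferInstance, ⟨⟨Sum.inl, Sum.inl_injective⟩, ?_, ?_⟩, isExSigmaModel_iff.2 h,
    Sum.inr true, (isExSigmaModel_iff.1 hK).equivE.refl a, .inr trivial, ?_⟩
  · intro n f x
    match n, f, x with
    | _, Sum.inl f, _ => exact Empty.elim f
    | 0, Sum.inr f, _ => exact Empty.elim f
    | 1, Sum.inr f, x =>
      obtain ⟨a, rfl⟩ : ∃ a, x = ![a] := ⟨x 0, by ext j; fin_cases j; rfl⟩
      rfl
    | _ + 2, Sum.inr f, _ => exact Empty.elim f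
  · intro n S x
    match n, S, x with
    | _, Sum.inr S, _ => exact Empty.elim S
    | 0, Sum.inl S, _ => exact Empty.elim S
    | 1, Sum.inl i, x =>
      obtain ⟨a, rfl⟩ : ∃ a, x = ![a] := ⟨x 0, by ext j; fin_cases j; rfl⟩
      exact Iff.rfl
    | 2, Sum.inl S, x =>
      obtain ⟨a, b, rfl⟩ : ∃ a b, x = ![a, b] := ⟨x 0, x 1, by ext j; fin_cases j <;> rfl⟩
      cases S
      · exact Sum.liftRel_inl_inl
      · exact Iff.rfl
    | _ + 3, Sum.inl S, _ => exact Empty.elim S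
  · exact fun h' => Bool.false_ne_true (Sum.inr_injective h')

/-! ### The formulas transferred along elementary maps -/

/-- The term `σ(t)`. -/
def sigmaTerm {α : Type*} (t : (Lsig exLang).Term α) : (Lsig exLang).Term α :=
  Functions.apply₁ (L := Lsig exLang) (Sum.inr sigSymb) t

theorem realize_sigmaTerm {α : Type*} (t : (Lsig exLang).Term α) (v : α → M) :
    (sigmaTerm t).realize v = sigmaMap exLang M (t.realize v) :=
  Term.realize_functions_apply₁

/-- The formula stating that `σ` swaps some two-element `R`-class inside the class of `a`. -/
def swapFormula : (Lsig exLang).Formula (Fin 1) :=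
  ((Relations.boundedFormula₂ (L := Lsig exLang) (Sum.inl Esym) (Term.var (Sum.inl 0)) (&0)) ⊓
    ((Relations.boundedFormula₂ (L := Lsig exLang) (Sum.inl Rsym) (&0) (sigmaTerm (&0))) ⊓
      ∼((sigmaTerm (&0)).bdEqual (&0)) : (Lsig exLang).BoundedFormula (Fin 1) 1)).ex

theorem realize_swapFormula (v : Fin 1 → M) :
    swapFormula.Realize v ↔
      ∃ x : M, relE (v 0) x ∧ relR x (sigmaMap exLang M x) ∧ sigmaMap exLang M x ≠ x := by
  rw [swapFormula, Formula.Realize, BoundedFormula.realize_ex]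
  refine exists_congr fun x => ?_
  rw [BoundedFormula.realize_inf, BoundedFormula.realize_inf, BoundedFormula.realize_not,
    BoundedFormula.realize_bdEqual, realize_sigmaTerm]
  refine and_congr BoundedFormula.realize_rel₂ (and_congr ?_ Iff.rfl)
  refine BoundedFormula.realize_rel₂.trans ?_
  rw [realize_sigmaTerm]
  rfl

/-- The formula `E(x, σ(y))`. -/
def fixFormula : (Lsig exLang).Formula (Fin 2) :=
  Relations.formula₂ (L := Lsig exLang) (Sum.inl Esym) (Term.var 0) (sigmaTerm (Term.var 1))

theorem realize_fixFormula (v : Fin 2 → M) :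
    fixFormula.Realize v ↔ relE (v 0) (sigmaMap exLang M (v 1)) := by
  refine Formula.realize_rel₂.trans ?_
  rw [realize_sigmaTerm]
  rfl

/-- The formula `E(x, y)`. -/
def equivFormula : (Lsig exLang).Formula (Fin 2) :=
  Relations.formula₂ (L := Lsig exLang) (Sum.inl Esym) (Term.var 0) (Term.var 1)

theorem realize_equivFormula (v : Fin 2 → M) : equivFormula.Realize v ↔ relE (v 0) (v 1) :=
  Formula.realize_rel₂

/-- The formula `P_i(x)`. -/
def predFormula (i : ℕ) : (Lsig exLang).Formula (Fin 1) :=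
  Relations.formula₁ (L := Lsig exLang) (Sum.inl (Psym i)) (Term.var 0)

theorem realize_predFormula (i : ℕ) (v : Fin 1 → M) :
    (predFormula i).Realize v ↔ relP i (v 0) :=
  Formula.realize_rel₁

/-! ### The example theory has no model companion with an automorphism -/

/-- For the example theory, `T_σ` has no model companion: in an ultrapower of a model of a model
companion in which the `P_i` live on distinct classes, some class fixed by `σ` carries no `P_i`,
yet no `R`-class inside it is swapped by `σ`. -/
theorem not_modelCompanion (T' : (Lsig exLang).Theory) (hcomplete : IsModelComplete T')
    (hext : ∀ (M : Type) [(Lsig exLang).Structure M] [Nonempty M], IsExSigmaModel M →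
      ∃ (N : Type) (_ : (Lsig exLang).Structure N), Nonempty N ∧ (N ⊨ T') ∧
        Nonempty (M ↪[Lsig exLang] N))
    (hsub : ∀ (N : Type) [(Lsig exLang).Structure N] [Nonempty N], N ⊨ T' →
      ∃ (M : Type) (_ : (Lsig exLang).Structure M), Nonempty M ∧ IsExSigmaModel M ∧
        Nonempty (N ↪[Lsig exLang] M)) : False := by
  let _ := exStructure (M := ℕ × ℕ × Bool) (fun x y => x.1 = y.1)
    (fun x y => x.1 = y.1 ∧ x.2.1 = y.2.1) (fun i x => x.1 = i ∧ x.2.2 = true) id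
  obtain ⟨M, _, _, hM, ⟨g⟩⟩ :=
    hext (ℕ × ℕ × Bool) (isExSigmaModel_exStructure exAxioms_separated)
  obtain ⟨K, _, _, hK, ⟨f⟩⟩ := hsub M hM
  rw [isExSigmaModel_iff] at hK
  let p : ℕ → M := fun i => g (i, 0, true)
  have hp : ∀ i, relP i (p i) := fun i => (relP_map g i _).2 ⟨rfl, rfl⟩
  have hpE : ∀ i j, relE (p i) (p j) → i = j := fun i j h => (relE_map g _ _).1 h
  have hfix : ∀ i, relE (p i) (sigmaMap exLang M (p i)) := fun i => by
    rw [← relE_map f, ← sigmaMap_map]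
    have h := (relP_map f i _).2 (hp i)
    exact hK.one_class i _ _ h ((hK.map_P _ _).2 h)
  have hswap : ∀ i, ¬ swapFormula.Realize (fun _ : Fin 1 => p i) := fun i h => by
    obtain ⟨x, hx, hR, hne⟩ := (realize_swapFormula _).1 h
    rw [← relE_map f] at hx
    rw [← relR_map f, ← sigmaMap_map] at hR
    exact hne (f.injective ((sigmaMap_map f x).symm.trans
      (hK.fixed_of_pred ((relP_map f i _).2 (hp i)) hx hR)))
  let u : Ultrafilter ℕ := Filter.hyperfilter ℕ
  let U : Type := (u : Filter ℕ).Product fun _ => M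
  have hU : U ⊨ T' := ⟨fun φ hφ => (Ultraproduct.sentence_realize φ).2
    (Filter.Eventually.of_forall fun _ => hM.realize_of_mem φ hφ)⟩
  let q : U := ((p : ℕ → M) : (u : Filter ℕ).Product fun _ => M)
  let c : ℕ → U := fun i => ((fun _ => p i : ℕ → M) : (u : Filter ℕ).Product fun _ => M)
  have hqfix : relE q (sigmaMap exLang U q) :=
    (realize_fixFormula fun _ => q).1 ((Ultraproduct.realize_formula_cast fixFormula
      (fun _ => p)).2 (Filter.Eventually.of_forall fun i => (realize_fixFormula _).2 (hfix i)))
  have hcP : ∀ i, relP i (c i) := fun i =>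
    (realize_predFormula i fun _ => c i).1 ((Ultraproduct.realize_formula_cast (predFormula i)
      (fun _ _ => p i)).2 (Filter.Eventually.of_forall fun _ => (realize_predFormula i _).2 (hp i)))
  have hcq : ∀ i, ¬ relE (c i) q := fun i h => by
    have hv : (fun j : Fin 2 => ((![fun _ => p i, p] j : ℕ → M) :
        (u : Filter ℕ).Product fun _ => M)) = ![c i, q] := by
      ext j; fin_cases j <;> rfl
    have h' := (realize_equivFormula ![c i, q]).2 h
    rw [← hv] at h'
    have hev := (Ultraproduct.realize_formula_cast equivFormula _).1 h'
    have hfin : ∀ᶠ n in (u : Filter ℕ), n = i :=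
      hev.mono fun n hn => (hpE i n ((realize_equivFormula _).1 hn)).symm
    exact Filter.notMem_hyperfilter_of_finite (Set.finite_singleton i) hfin
  have hqswap : ¬ swapFormula.Realize (fun _ : Fin 1 => q) := fun h => by
    obtain ⟨i, hi⟩ := ((Ultraproduct.realize_formula_cast swapFormula (fun _ => p)).1 h).exists
    exact hswap i hi
  obtain ⟨K₁, _, _, hK₁, ⟨f₁⟩⟩ := hsub U hU
  have hax := isExSigmaModel_iff.1 hK₁
  obtain ⟨K₂, _, f₂, hK₂, x, hxE, hxR, hne⟩ := exists_embedding_swapped_pair hK₁ (a := f₁ q)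
    (by rwa [sigmaMap_map, relE_map]) (fun i x hx hxq => hcq i <| (relE_map f₁ _ _).1 <|
      hax.equivE.trans (hax.one_class i _ _ ((relP_map f₁ i _).2 (hcP i)) hx) hxq)
  have : Nonempty K₂ := ⟨x⟩
  obtain ⟨N, _, _, hN, ⟨f₃⟩⟩ := hext K₂ hK₂
  refine hqswap ((hcomplete U N hU hN (f₃.comp (f₂.comp f₁)) 1 swapFormula _).1
    ((realize_swapFormula _).2 ⟨f₃ x, (relE_map f₃ _ _).2 hxE, ?_, ?_⟩))
  · rwa [sigmaMap_map, relR_map]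
  · rw [sigmaMap_map]
    exact fun h => hne (f₃.injective h)

end Helpers

/-- in the example theory, if `T_σ` has a model companion `T*_σ`, then
for some finite `Δ` and `k`, `T*_σ ⊢ θ_{Δ,k}`: every model of `T*_σ` satisfies that any
`b̄, c̄, a` realizing `χ_{Δ,k}` (the `Δ`-formulas satisfied by an initial segment of a
realization of `Γ`) admit `x_0,y_0,x_1,y_1` with
`ψ(x_0,y_0,a) ∧ ψ(x_1,y_1,a) ∧ σ(x_1) = y_1`. -/
theorem example_modelCompanion_proves_theta
    (T' : (Lsig exLang).Theory)
    (hmc : IsModelComplete T' ∧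
      (∀ (M : Type) [(Lsig exLang).Structure M] [Nonempty M], IsExSigmaModel M →
        ∃ (N : Type) (_ : (Lsig exLang).Structure N), Nonempty N ∧ (N ⊨ T') ∧
          Nonempty (M ↪[Lsig exLang] N)) ∧
      (∀ (N : Type) [(Lsig exLang).Structure N] [Nonempty N], N ⊨ T' →
        ∃ (M : Type) (_ : (Lsig exLang).Structure M), Nonempty M ∧ IsExSigmaModel M ∧
          Nonempty (N ↪[Lsig exLang] M)))
    (N : Type) [(Lsig exLang).Structure N] [Nonempty N] (hN : IsExSigmaModel N)
    (w : ℕ → N × N) (aN : N) (hΓ : RealizesGamma N w aN) :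
    ∃ (Δ : Set ((m : ℕ) × exLang.Formula (Fin m))) (k : ℕ), Δ.Finite ∧
      ∀ (M : Type) [(Lsig exLang).Structure M] [Nonempty M], M ⊨ T' →
        ∀ (b c : Fin k → M) (a : M),
          (∀ mφ : (m : ℕ) × exLang.Formula (Fin m), mφ ∈ Δ →
            ∀ ρ : Fin mφ.1 → Fin (2 * k + 1),
              (letI := redL exLang N;
                mφ.2.Realize (arrTup k (fun i => (w i).1) (fun i => (w i).2) aN ∘ ρ)) →
              (letI := redL exLang M; mφ.2.Realize (arrTup k b c a ∘ ρ))) →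
          ∃ x0 y0 x1 y1 : M,
            PsiSat x0 y0 a ∧ PsiSat x1 y1 a ∧ sigmaMap exLang M x1 = y1 := by
  exact (not_modelCompanion T' hmc.1 hmc.2.1 hmc.2.2).elim

end PaperAut
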